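/- arXiv:2409.16119 — 2 statements merged into one kernel-verified Lean document; each statement's English description precedes it below -/
import Mathlib

section
/- Let G = (V,E) be a connected loopless multigraph and let b = |B(G)| be the maximum size of a bond of G. Then for every ε > 0 there exist rates λ_e > 0, e ∈ E, such that, with edge weights and samples independent exponential random variables of rate λ_e, the sampling algorithm SAM satisfies E_{w̃}[ Σ_{e∈T^SAM(w̃)} 1/λ_e ] ≥ (b − ε) · OPT, where OPT = min over spanning trees T of Σ_{e∈T} 1/λ_e. Equivalently, the supremum over all rate vectors λ of the ratio E[SAM]/OPT is at least |B(G)|. -/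
open scoped Classical

/-- A loopless multigraph on vertex type `V` with edge type `E`:
each edge has two distinct endpoints, parallel edges are allowed. -/
structure Multigraph (V : Type*) (E : Type*) where
  ends : E → Sym2 V
  loopless : ∀ e, ¬ (ends e).IsDiag

namespace Multigraph

variable {V E : Type*} (G : Multigraph V E)

/-- `u` and `v` are joined by a walk using only edges in `F`. -/
def Reach (F : Set E) (u v : V) : Prop :=
  Relation.ReflTransGen (fun x y => ∃ e ∈ F, G.ends e = s(x, y)) u v

/-- The subgraph with edge set `F` (and all vertices) is connected. -/
def ConnectedOn (F : Set E) : Prop := ∀ u v : V, G.Reach F u v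

/-- The multigraph is connected. -/
def Connected : Prop := G.ConnectedOn Set.univ

/-- A cut set of a connected multigraph: removing its edges disconnects the graph. -/
def CutSet (C : Set E) : Prop := ¬ G.ConnectedOn Cᶜ

/-- A bond: an inclusion-wise minimal cut set. -/
def IsBond (C : Set E) : Prop := G.CutSet C ∧ ∀ C' ⊂ C, ¬ G.CutSet C'

/-- The maximum size of a bond, `|B(G)|`. -/
noncomputable def maxBondSize : ℕ := sSup {n | ∃ C : Set E, G.IsBond C ∧ C.ncard = n}

/-- A set of edges is acyclic (contains no cycle) iff no edge of it joins
two vertices that are already connected by the remaining edges. -/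
def Acyclic (F : Set E) : Prop :=
  ∀ e ∈ F, ∀ u v : V, G.ends e = s(u, v) → ¬ G.Reach (F \ {e}) u v

/-- A spanning tree: a set of `|V| - 1` edges containing no cycle. -/
def IsSpanningTree (T : Set E) : Prop :=
  T.ncard = Nat.card V - 1 ∧ G.Acyclic T

/-- The total weight of an edge set. -/
noncomputable def weight (w : E → ℝ) (T : Set E) : ℝ := ∑ᶠ e ∈ T, w e

/-- A minimum spanning tree with respect to edge weights `w`. -/
def IsMST (w : E → ℝ) (T : Set E) : Prop :=
  G.IsSpanningTree T ∧ ∀ T', G.IsSpanningTree T' → weight w T ≤ weight w T'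

/-- `f` lies on the (unique) `u`-`v` path in the tree `T`: it belongs to `T` and
removing it from `T` disconnects `u` from `v`. -/
def OnPath (T : Set E) (u v : V) (f : E) : Prop :=
  f ∈ T ∧ ¬ G.Reach (T \ {f}) u v

/-- The vertex identification produced by contracting the edge `e`. -/
def contractSetoid (e : E) : Setoid V where
  r x y := x = y ∨ G.ends e = s(x, y)
  iseqv := by
    refine ⟨fun x => Or.inl rfl, ?_, ?_⟩
    · rintro x y (rfl | h)
      · exact Or.inl rfl
      · right; rwa [Sym2.eq_swap]
    · rintro x y z (rfl | hxy) (rfl | hyz)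
      · exact Or.inl rfl
      · exact Or.inr hyz
      · exact Or.inr hxy
      · rw [hxy] at hyz
        rw [Sym2.eq_iff] at hyz
        rcases hyz with ⟨rfl, rfl⟩ | ⟨rfl, -⟩
        · exact Or.inl rfl
        · exact Or.inl rfl

/-- The contraction `G/e`: the endpoints of `e` are merged into a single vertex,
`e` is removed, and all resulting loops (the edges parallel to `e`) are deleted. -/
def contract (e : E) :
    Multigraph (Quotient (G.contractSetoid e)) {f : E // f ≠ e ∧ G.ends f ≠ G.ends e} where
  ends f := (G.ends f.1).map (Quotient.mk (G.contractSetoid e))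
  loopless := by
    rintro ⟨f, hfe, hff⟩ h
    obtain ⟨x, y, hf⟩ : ∃ x y, G.ends f = s(x, y) := by
      induction G.ends f using Sym2.inductionOn with
      | hf x y => exact ⟨x, y, rfl⟩
    simp only [hf, Sym2.map_pair_eq] at h
    rcases Quotient.eq''.mp (h : _ = _) with (rfl | hxy)
    · exact G.loopless f (by rw [hf]; exact rfl)
    · exact hff (by rw [hf, hxy])

end Multigraph

namespace Multigraph

theorem reach_mono {V E : Type*} (G : Multigraph V E) {F F' : Set E} (h : F ⊆ F') {u v : V}
    (hr : G.Reach F u v) : G.Reach F' u v :=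
  Relation.ReflTransGen.mono (fun _ _ ⟨e, he, h'⟩ => ⟨e, h he, h'⟩) _ _ hr

theorem reach_symm {V E : Type*} (G : Multigraph V E) {F : Set E} {u v : V}
    (hr : G.Reach F u v) : G.Reach F v u := by
  induction hr with
  | refl => exact Relation.ReflTransGen.refl
  | tail _ hstep ih =>
    obtain ⟨e, he, h⟩ := hstep
    exact Relation.ReflTransGen.head ⟨e, he, by rw [h, Sym2.eq_swap]⟩ ih

theorem reach_trans {V E : Type*} (G : Multigraph V E) {F : Set E} {u v w : V}
    (h : G.Reach F u v) (h' : G.Reach F v w) : G.Reach F u w :=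
  Relation.ReflTransGen.trans h h'

theorem reach_edge {V E : Type*} (G : Multigraph V E) {F : Set E} {u v : V} {e : E}
    (he : e ∈ F) (h : G.ends e = s(u, v)) : G.Reach F u v :=
  Relation.ReflTransGen.single ⟨e, he, h⟩

theorem reach_of_edges {V E : Type*} (G : Multigraph V E) {F F' : Set E}
    (h : ∀ e ∈ F, ∀ u v, G.ends e = s(u, v) → G.Reach F' u v) {u v : V}
    (hr : G.Reach F u v) : G.Reach F' u v := by
  induction hr with
  | refl => exact Relation.ReflTransGen.refl
  | tail _ hstep ih =>
    obtain ⟨e, he, h'⟩ := hstep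
    exact G.reach_trans ih (h e he _ _ h')

theorem reach_split {V E : Type*} (G : Multigraph V E) {F F' : Set E} {f : E}
    (hF : F ⊆ insert f F') {u v : V} (hr : G.Reach F u v) :
    G.Reach F' u v ∨
      ∃ a b, G.ends f = s(a, b) ∧ G.Reach F' u a ∧ G.Reach F' b v := by
  induction hr with
  | refl => exact Or.inl Relation.ReflTransGen.refl
  | @tail x y _ hstep ih =>
    obtain ⟨e, he, h⟩ := hstep
    rcases hF he with rfl | he'
    · rcases ih with ih | ⟨a, b, hab, h1, h2⟩
      · exact Or.inr ⟨x, y, h, ih, Relation.ReflTransGen.refl⟩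
      · have h' := h
        rw [hab, Sym2.eq_iff] at h'
        rcases h' with ⟨rfl, rfl⟩ | ⟨rfl, rfl⟩
        · exact Or.inr ⟨a, b, h, h1, Relation.ReflTransGen.refl⟩
        · exact Or.inl h1
    · have hxy := G.reach_edge he' h
      rcases ih with ih | ⟨a, b, hab, h1, h2⟩
      · exact Or.inl (G.reach_trans ih hxy)
      · exact Or.inr ⟨a, b, hab, h1, G.reach_trans h2 hxy⟩

theorem acyclic_mono {V E : Type*} (G : Multigraph V E) {F F' : Set E} (h : F ⊆ F')
    (hF : G.Acyclic F') : G.Acyclic F := fun e he u v huv hr =>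
  hF e (h he) u v huv (G.reach_mono (Set.sdiff_subset_sdiff_left h) hr)

theorem acyclic_insert {V E : Type*} (G : Multigraph V E) {F : Set E} {e : E} {u v : V}
    (hF : G.Acyclic F) (he : G.ends e = s(u, v)) (hn : ¬ G.Reach F u v) :
    G.Acyclic (insert e F) := by
  intro g hg x y hxy hr
  by_cases hge : g = e
  · subst hge
    have hr' : G.Reach F x y := by
      refine G.reach_mono ?_ hr
      rintro a ⟨rfl | ha, h2⟩
      · exact absurd rfl h2
      · exact ha
    rw [he, Sym2.eq_iff] at hxy
    rcases hxy with ⟨rfl, rfl⟩ | ⟨rfl, rfl⟩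
    · exact hn hr'
    · exact hn (G.reach_symm hr')
  · have hgF : g ∈ F := by
      rcases hg with h | h
      · exact absurd h hge
      · exact h
    have hsub : insert e F \ {g} ⊆ insert e (F \ {g}) := by
      rintro a ⟨rfl | ha, h2⟩
      · exact Or.inl rfl
      · exact Or.inr ⟨ha, h2⟩
    rcases G.reach_split hsub hr with h | ⟨a, b, hab, h1, h2⟩
    · exact hF g hgF x y hxy h
    · have h1' := G.reach_mono Set.sdiff_subset h1
      have h2' := G.reach_mono Set.sdiff_subset h2
      have h3 : G.Reach F a b :=
        G.reach_trans (G.reach_symm h1') (G.reach_trans (G.reach_edge hgF hxy) (G.reach_symm h2'))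
      rw [he, Sym2.eq_iff] at hab
      rcases hab with ⟨rfl, rfl⟩ | ⟨rfl, rfl⟩
      · exact hn h3
      · exact hn (G.reach_symm h3)

/-- The connected-component equivalence relation. -/
def compSetoid {V E : Type*} (G : Multigraph V E) (F : Set E) : Setoid V where
  r := G.Reach F
  iseqv := ⟨fun _ => Relation.ReflTransGen.refl, G.reach_symm, G.reach_trans⟩

/-- Number of connected components. -/
noncomputable def comps {V E : Type*} (G : Multigraph V E) (F : Set E) : ℕ :=
  Nat.card (Quotient (G.compSetoid F))

theorem comps_insert {V E : Type*} [Finite V] (G : Multigraph V E) {F : Set E} {e : E} {u v : V}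
    (he : G.ends e = s(u, v)) (hn : ¬ G.Reach F u v) :
    G.comps F = G.comps (insert e F) + 1 := by
  let sF := G.compSetoid F
  let sF' := G.compSetoid (insert e F)
  have key : ∀ x y, G.Reach (insert e F) x y → ¬ G.Reach F x v → ¬ G.Reach F y v →
      G.Reach F x y := by
    intro x y hr hx hy
    rcases G.reach_split (subset_refl _) hr with h | ⟨a, b, hab, h1, h2⟩
    · exact h
    · rw [he, Sym2.eq_iff] at hab
      rcases hab with ⟨rfl, rfl⟩ | ⟨rfl, rfl⟩
      · exact absurd (G.reach_symm h2) hy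
      · exact absurd h1 hx
  let vq : Quotient sF := Quotient.mk sF v
  let φ : Quotient sF → Quotient sF' :=
    Quotient.map' id (fun x y h => G.reach_mono (Set.subset_insert _ _) h)
  let ψ : {q : Quotient sF // q ≠ vq} → Quotient sF' := fun q => φ q.1
  have hbij : Function.Bijective ψ := by
    constructor
    · rintro ⟨p, hp⟩ ⟨q, hq⟩ h
      induction p using Quotient.inductionOn with | _ x
      induction q using Quotient.inductionOn with | _ y
      have h' : G.Reach (insert e F) x y := Quotient.exact (s := sF') h
      have hx : ¬ G.Reach F x v := fun h => hp (Quotient.sound h)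
      have hy : ¬ G.Reach F y v := fun h => hq (Quotient.sound h)
      exact Subtype.ext (Quotient.sound (key x y h' hx hy))
    · intro q
      induction q using Quotient.inductionOn with | _ x
      by_cases hx : G.Reach F x v
      · refine ⟨⟨Quotient.mk sF u, fun h => hn (Quotient.exact h)⟩, ?_⟩
        refine Quotient.sound (s := sF') ?_
        exact G.reach_trans (G.reach_edge (Set.mem_insert _ _) he)
          (G.reach_mono (Set.subset_insert _ _) (G.reach_symm hx))
      · exact ⟨⟨Quotient.mk sF x, fun h => hx (Quotient.exact h)⟩, rfl⟩
  have h1 : Nat.card {q : Quotient sF // q ≠ vq} = G.comps (insert e F) :=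
    Nat.card_eq_of_bijective ψ hbij
  rw [← h1]
  have h2 := Set.ncard_add_ncard_compl ({vq} : Set (Quotient sF))
  rw [Set.ncard_singleton] at h2
  have h3 : Nat.card {q : Quotient sF // q ≠ vq} = ({vq}ᶜ : Set (Quotient sF)).ncard := rfl
  rw [h3]
  change Nat.card (Quotient sF) = _
  omega

theorem comps_acyclic {V E : Type*} [Finite V] [Finite E] (G : Multigraph V E) (F : Set E)
    (hF : G.Acyclic F) : F.ncard + G.comps F = Nat.card V := by
  induction F, Set.toFinite F using Set.Finite.induction_on with
  | empty =>
    rw [Set.ncard_empty, zero_add]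
    refine (Nat.card_eq_of_bijective (Quotient.mk (G.compSetoid ∅)) ⟨?_, ?_⟩).symm
    · intro x y h
      have h' : G.Reach ∅ x y := Quotient.exact h
      clear h
      induction h' with
      | refl => rfl
      | tail _ h _ => obtain ⟨e, he, _⟩ := h; exact absurd he (Set.notMem_empty _)
    · exact Quotient.mk_surjective
  | @insert e F he _ ih =>
    have ih' := ih (G.acyclic_mono (Set.subset_insert _ _) hF)
    obtain ⟨u, v, huv⟩ : ∃ u v, G.ends e = s(u, v) := by
      induction G.ends e using Sym2.inductionOn with
      | hf x y => exact ⟨x, y, rfl⟩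
    have hn : ¬ G.Reach F u v := by
      have := hF e (Set.mem_insert _ _) u v huv
      rwa [Set.insert_sdiff_self_of_notMem he] at this
    rw [Set.ncard_insert_of_notMem he, ← ih', G.comps_insert huv hn]
    omega

theorem spanningTree_connected {V E : Type*} [Finite V] [Finite E] (G : Multigraph V E)
    {T : Set E} (hT : G.IsSpanningTree T) : G.ConnectedOn T := by
  intro u v
  have h := G.comps_acyclic T hT.2
  have hV : 0 < Nat.card V := by
    have : Nonempty V := ⟨u⟩
    exact Nat.card_pos
  rw [hT.1] at h
  have h1 : Nat.card (Quotient (G.compSetoid T)) ≤ 1 := by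
    unfold comps at h; omega
  have : Subsingleton (Quotient (G.compSetoid T)) := Finite.card_le_one_iff_subsingleton.mp h1
  exact Quotient.exact (Subsingleton.elim (Quotient.mk (G.compSetoid T) u) (Quotient.mk _ v))

theorem exists_spanningTree {V E : Type*} [Finite V] [Finite E] [Nonempty V] (G : Multigraph V E)
    {F : Set E} (hF : G.ConnectedOn F) : ∃ T ⊆ F, G.IsSpanningTree T := by
  obtain ⟨T, hT⟩ := (Set.toFinite {T : Set E | T ⊆ F ∧ G.Acyclic T}).exists_maximal
    ⟨∅, Set.empty_subset _, fun e he => absurd he (Set.notMem_empty _)⟩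
  refine ⟨T, hT.prop.1, ?_, hT.prop.2⟩
  have hc : ∀ u v, G.Reach T u v := by
    intro u v
    refine G.reach_of_edges ?_ (hF u v)
    intro e he a b hab
    by_contra hn
    have h1 := hT.le_of_ge (y := insert e T)
      ⟨Set.insert_subset he hT.prop.1, G.acyclic_insert hT.prop.2 hab hn⟩ (Set.subset_insert _ _)
    exact hn (G.reach_edge (h1 (Set.mem_insert _ _)) hab)
  have h := G.comps_acyclic T hT.prop.2
  have h1 : G.comps T = 1 := by
    unfold comps
    rw [Nat.card_eq_one_iff_unique]
    refine ⟨⟨fun p q => ?_⟩, ⟨Quotient.mk _ (Classical.arbitrary V)⟩⟩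
    induction p using Quotient.inductionOn with | _ x
    induction q using Quotient.inductionOn with | _ y
    exact Quotient.sound (hc x y)
  omega

theorem weight_eq_sum {E : Type*} [Fintype E] (w : E → ℝ) (T : Set E) :
    weight w T = ∑ e, if e ∈ T then w e else 0 := by
  unfold weight
  rw [finsum_eq_sum_of_fintype]
  refine Finset.sum_congr rfl fun e _ => ?_
  exact finsum_eq_if

/-- Cut property: a strictly lightest edge of a bond lies in every MST. -/
theorem mem_mst_of_strict_min {V E : Type*} [Finite V] [Fintype E] (G : Multigraph V E)
    {C T : Set E} (hC : G.IsBond C) (x : E → ℝ) (hT : G.IsMST x T) {e : E} (he : e ∈ C)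
    (hmin : ∀ f ∈ C, f ≠ e → x e < x f) : e ∈ T := by
  by_contra heT
  obtain ⟨u, v, huv⟩ : ∃ u v, G.ends e = s(u, v) := by
    induction G.ends e using Sym2.inductionOn with
    | hf x y => exact ⟨x, y, rfl⟩
  have hnC : ¬ G.Reach Cᶜ u v := by
    intro hr
    have h1 := hC.2 (C \ {e}) ⟨Set.sdiff_subset, fun h => (h he).2 rfl⟩
    apply hC.1
    unfold CutSet at h1
    rw [not_not] at h1
    intro a b
    refine G.reach_of_edges ?_ (h1 a b)
    intro g hg p q hpq
    by_cases hge : g = e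
    · subst hge
      rw [huv, Sym2.eq_iff] at hpq
      rcases hpq with ⟨rfl, rfl⟩ | ⟨rfl, rfl⟩
      · exact hr
      · exact G.reach_symm hr
    · exact G.reach_edge (fun hgC => hg ⟨hgC, hge⟩) hpq
  have hTc := G.spanningTree_connected hT.1
  obtain ⟨P, hP⟩ := (Set.toFinite {P : Set E | P ⊆ T ∧ G.Reach P u v}).exists_minimal
    ⟨T, subset_rfl, hTc u v⟩
  obtain ⟨f, hfP, hfC⟩ : ∃ f ∈ P, f ∈ C := by
    by_contra hne
    push Not at hne
    exact hnC (G.reach_mono hne hP.prop.2)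
  have hfT : f ∈ T := hP.prop.1 hfP
  have hfe : f ≠ e := by rintro rfl; exact heT hfT
  have hnP : ¬ G.Reach (P \ {f}) u v := by
    intro hr
    exact (hP.le_of_le (y := P \ {f}) ⟨Set.sdiff_subset.trans hP.prop.1, hr⟩ Set.sdiff_subset hfP).2
      rfl
  have hnT : ¬ G.Reach (T \ {f}) u v := by
    intro hr
    have hsub : P ⊆ insert f (P \ {f}) := by
      intro a ha
      by_cases haf : a = f
      · exact Or.inl haf
      · exact Or.inr ⟨ha, haf⟩
    rcases G.reach_split hsub hP.prop.2 with h | ⟨a, b, hab, h1, h2⟩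
    · exact hnP h
    · have hs : P \ {f} ⊆ T \ {f} := Set.sdiff_subset_sdiff_left hP.prop.1
      exact hT.1.2 f hfT a b hab (G.reach_trans (G.reach_symm (G.reach_mono hs h1))
        (G.reach_trans hr (G.reach_symm (G.reach_mono hs h2))))
  have heTf : e ∉ T \ {f} := fun h => heT h.1
  have hT' : G.IsSpanningTree (insert e (T \ {f})) := by
    refine ⟨?_, G.acyclic_insert (G.acyclic_mono Set.sdiff_subset hT.1.2) huv hnT⟩
    rw [Set.ncard_insert_of_notMem heTf, Set.ncard_sdiff_singleton_add_one hfT]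
    exact hT.1.1
  have hle := hT.2 _ hT'
  have hlt := hmin f hfC hfe
  have h1 : weight x (insert e (T \ {f})) = x e + weight x (T \ {f}) :=
    finsum_mem_insert _ heTf (Set.toFinite _)
  have h2 : weight x (insert f (T \ {f})) = x f + weight x (T \ {f}) :=
    finsum_mem_insert _ (fun h => h.2 rfl) (Set.toFinite _)
  rw [Set.insert_sdiff_singleton, Set.insert_eq_of_mem hfT] at h2
  linarith

end Multigraph

namespace SamProb
open MeasureTheory ProbabilityTheory

theorem expMeasure_Ioi {r t : ℝ} (hr : 0 < r) (ht : 0 ≤ t) :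
    expMeasure r (Set.Ioi t) = ENNReal.ofReal (Real.exp (-(r * t))) := by
  have := isProbabilityMeasure_expMeasure hr
  rw [← Set.compl_Iic, prob_compl_eq_one_sub measurableSet_Iic, ← ofReal_cdf,
    cdf_expMeasure_eq hr, if_pos ht, ← ENNReal.ofReal_one, ← ENNReal.ofReal_sub]
  · congr 1; ring
  · have : Real.exp (-(r * t)) ≤ 1 := Real.exp_le_one_iff.mpr (by nlinarith [mul_nonneg hr.le ht])
    linarith

theorem measurableSet_strict_min {E : Type*} [Fintype E] (C : Finset E) (e : E) :
    MeasurableSet {x : E → ℝ | ∀ f ∈ C, f ≠ e → x e < x f} := by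
  have : {x : E → ℝ | ∀ f ∈ C, f ≠ e → x e < x f} =
      ⋂ f ∈ C, ⋂ (_ : f ≠ e), {x : E → ℝ | x e < x f} := by
    ext x; simp
  rw [this]
  refine Finset.measurableSet_biInter _ fun f _ => MeasurableSet.iInter fun _ => ?_
  exact measurableSet_lt (measurable_pi_apply e) (measurable_pi_apply f)

theorem prob_strict_min {E : Type*} [Fintype E] (lam : E → ℝ) (hl : ∀ e, 0 < lam e)
    (C : Finset E) (e : E) (he : e ∈ C) :
    (Measure.pi fun e : E => expMeasure (lam e)) {x : E → ℝ | ∀ f ∈ C, f ≠ e → x e < x f}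
      = ENNReal.ofReal (lam e / ∑ f ∈ C, lam f) := by
  have hprob : ∀ e, IsProbabilityMeasure (expMeasure (lam e)) :=
    fun e => isProbabilityMeasure_expMeasure (hl e)
  set L := ∑ f ∈ C, lam f with hL
  have hLpos : 0 < L := Finset.sum_pos (fun f _ => hl f) ⟨e, he⟩
  have hLe : L = lam e + ∑ f ∈ C.erase e, lam f := (Finset.add_sum_erase C lam he).symm
  have hmp := measurePreserving_piEquivPiSubtypeProd
    (fun e : E => expMeasure (lam e)) (fun i => i = e)
  set μ2 := Measure.pi fun i : {i // ¬ i = e} => expMeasure (lam i) with hμ2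
  let B : Set (({i // i = e} → ℝ) × ({i // ¬ i = e} → ℝ)) :=
    {p | ∀ f : {i // ¬ i = e}, f.1 ∈ C → p.1 ⟨e, rfl⟩ < p.2 f}
  have hB : MeasurableSet B := by
    have : B = ⋂ f : {i // ¬ i = e}, ⋂ (_ : f.1 ∈ C), {p | p.1 ⟨e, rfl⟩ < p.2 f} := by
      ext x; simp [B]
    rw [this]
    refine MeasurableSet.iInter fun f => MeasurableSet.iInter fun _ => ?_
    exact measurableSet_lt ((measurable_pi_apply _).comp measurable_fst)
      ((measurable_pi_apply _).comp measurable_snd)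
  have hpre : {x : E → ℝ | ∀ f ∈ C, f ≠ e → x e < x f} =
      (MeasurableEquiv.piEquivPiSubtypeProd (fun _ : E => ℝ) (fun i => i = e)) ⁻¹' B := by
    ext x
    constructor
    · intro h f hf
      exact h f.1 hf f.2
    · intro h f hf hfe
      exact h ⟨f, hfe⟩ hf
  rw [hpre, hmp.measure_preimage hB.nullMeasurableSet, Measure.prod_apply hB]
  let g : ℝ → ENNReal := fun t =>
    ∏ f : {i // ¬ i = e}, expMeasure (lam f) (if f.1 ∈ C then Set.Ioi t else Set.univ)
  have hg : ∀ y : {i // i = e} → ℝ, μ2 (Prod.mk y ⁻¹' B) = g (y ⟨e, rfl⟩) := by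
    intro y
    have : Prod.mk y ⁻¹' B = Set.pi Set.univ
        (fun f : {i // ¬ i = e} => if f.1 ∈ C then Set.Ioi (y ⟨e, rfl⟩) else Set.univ) := by
      ext z
      simp only [B, Set.mem_preimage, Set.mem_ofPred_eq, Set.mem_pi, Set.mem_univ, true_imp_iff]
      refine forall_congr' fun f => ?_
      split_ifs with h <;> simp [h]
    rw [this, hμ2, Measure.pi_pi]
  simp_rw [hg]
  have hgm : Measurable g := by
    refine Finset.measurable_fun_prod _ fun f _ => ?_
    split_ifs
    · refine Antitone.measurable fun a b hab => measure_mono (Set.Ioi_subset_Ioi hab)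
    · exact measurable_const
  have hev := measurePreserving_eval (fun i : {i // i = e} => expMeasure (lam i)) ⟨e, rfl⟩
  refine (MeasurePreserving.lintegral_comp (ν := expMeasure (lam e))
    (g := fun y : {i // i = e} → ℝ => y ⟨e, rfl⟩) ?_ hgm).trans ?_
  · convert hev
  have h2 : ∫⁻ t, g t ∂(expMeasure (lam e)) = ∫⁻ t, exponentialPDF (lam e) t * g t := by
    have : expMeasure (lam e) = volume.withDensity (exponentialPDF (lam e)) := rfl
    rw [this, lintegral_withDensity_eq_lintegral_mul _ (by unfold exponentialPDF; fun_prop) hgm]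
    rfl
  rw [h2]
  have h3 : ∀ t, exponentialPDF (lam e) t * g t = ENNReal.ofReal (lam e / L) * exponentialPDF L t := by
    intro t
    rcases lt_or_ge t 0 with ht | ht
    · rw [exponentialPDF_of_neg ht, exponentialPDF_of_neg ht]; simp
    · have hgt : g t = ENNReal.ofReal (Real.exp (-((∑ f ∈ C.erase e, lam f) * t))) := by
        have e1 : g t = ∏ f : {i // ¬ i = e},
            (fun f : E => if f ∈ C then ENNReal.ofReal (Real.exp (-(lam f * t))) else 1) f := by
          refine Finset.prod_congr rfl fun f _ => ?_
          dsimp only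
          split_ifs
          · exact expMeasure_Ioi (hl _) ht
          · exact measure_univ
        rw [e1, Finset.prod_subtype (s := Finset.univ.erase e) (p := fun i => ¬ i = e)
          (by simp) (fun f : E => if f ∈ C then ENNReal.ofReal (Real.exp (-(lam f * t))) else 1) |>.symm,
          ← Finset.prod_filter]
        have e2 : (Finset.univ.erase e).filter (· ∈ C) = C.erase e := by
          ext a; simp
        rw [e2, ← ENNReal.ofReal_prod_of_nonneg (fun _ _ => (Real.exp_pos _).le), ← Real.exp_sum,
          Finset.sum_mul, Finset.sum_neg_distrib]
      rw [hgt, exponentialPDF_of_nonneg ht, exponentialPDF_of_nonneg ht,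
        ← ENNReal.ofReal_mul (mul_pos (hl e) (Real.exp_pos _)).le,
        ← ENNReal.ofReal_mul (div_pos (hl e) hLpos).le]
      congr 1
      have : Real.exp (-(L * t)) =
          Real.exp (-(lam e * t)) * Real.exp (-((∑ f ∈ C.erase e, lam f) * t)) := by
        rw [← Real.exp_add, hLe]; congr 1; ring
      rw [this]
      field_simp
  simp_rw [h3]
  rw [lintegral_const_mul _ (by unfold exponentialPDF; fun_prop), lintegral_exponentialPDF_eq_one hLpos, mul_one]

end SamProb

open Multigraph MeasureTheory ProbabilityTheory in
/-- For every connected loopless multigraph `G` and every `ε > 0` there are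
exponential rates `λ_e > 0` such that the sampling algorithm (minimum spanning tree for one
independent exponential sample per edge, any measurable tie-breaking) has expected true cost
at least `(b − ε) · OPT`, where `b = |B(G)|` and `OPT` is the minimum expected weight of a
spanning tree. -/
theorem exists_rates_sample_mst_expected_cost_ge {V E : Type*} [Finite V] [Fintype E]
    (G : Multigraph V E) (hG : G.Connected) (ε : ℝ) (hε : 0 < ε) :
    ∃ lam : E → ℝ, (∀ e, 0 < lam e) ∧
      ∀ TSAM : (E → ℝ) → Set E,
        (∀ t : Set E, MeasurableSet {x : E → ℝ | TSAM x = t}) →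
        (∀ x : E → ℝ, G.IsSpanningTree (TSAM x) ∧
          ∀ T, G.IsSpanningTree T → Multigraph.weight x (TSAM x) ≤ Multigraph.weight x T) →
        ((G.maxBondSize : ℝ) - ε) *
            sInf {c : ℝ | ∃ T, G.IsSpanningTree T ∧ c = Multigraph.weight (fun e => 1 / lam e) T}
          ≤ ∫ x, Multigraph.weight (fun e => 1 / lam e) (TSAM x)
              ∂(Measure.pi fun e : E => expMeasure (lam e)) := by
  have hsInf_nonneg : ∀ lam : E → ℝ, (∀ e, 0 < lam e) → 0 ≤
      sInf {c : ℝ | ∃ T, G.IsSpanningTree T ∧ c = Multigraph.weight (fun e => 1 / lam e) T} := by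
    intro lam hl
    refine Real.sInf_nonneg ?_
    rintro c ⟨T, _, rfl⟩
    exact finsum_nonneg fun e => finsum_nonneg fun _ => (one_div_pos.mpr (hl e)).le
  have hint_nonneg : ∀ lam : E → ℝ, (∀ e, 0 < lam e) → ∀ TSAM : (E → ℝ) → Set E, 0 ≤
      ∫ x, Multigraph.weight (fun e => 1 / lam e) (TSAM x)
        ∂(Measure.pi fun e : E => expMeasure (lam e)) := by
    intro lam hl TSAM
    refine integral_nonneg fun x => ?_
    exact finsum_nonneg fun e => finsum_nonneg fun _ => (one_div_pos.mpr (hl e)).le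
  rcases le_or_gt ((G.maxBondSize : ℝ) - ε) 0 with hb | hb
  · refine ⟨fun _ => 1, fun _ => one_pos, fun TSAM _ _ => ?_⟩
    exact (mul_nonpos_of_nonpos_of_nonneg hb (hsInf_nonneg _ fun _ => one_pos)).trans
      (hint_nonneg _ (fun _ => one_pos) TSAM)
  -- a maximum bond
  obtain ⟨C, hC, hCb⟩ : ∃ C : Set E, G.IsBond C ∧ C.ncard = G.maxBondSize := by
    refine Nat.sSup_mem (s := {n | ∃ C : Set E, G.IsBond C ∧ C.ncard = n}) ?_ ?_
    · by_contra hne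
      rw [Set.not_nonempty_iff_eq_empty] at hne
      have : G.maxBondSize = 0 := by unfold maxBondSize; rw [hne]; simp
      rw [this] at hb
      simp at hb
      linarith
    · refine ⟨Nat.card E, ?_⟩
      rintro n ⟨C, _, rfl⟩
      exact Set.ncard_le_card C
  have hCne : C.Nonempty := by
    rw [Set.nonempty_iff_ne_empty]
    rintro rfl
    apply hC.1
    rw [Set.compl_empty]
    exact hG
  obtain ⟨e₁, he₁⟩ := hCne
  have hVne : Nonempty V := by
    induction G.ends e₁ using Sym2.inductionOn with
    | hf x y => exact ⟨x⟩
  set b := G.maxBondSize with hbdef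
  let D : Finset E := C.toFinset
  have hD : ∀ e, e ∈ D ↔ e ∈ C := fun e => Set.mem_toFinset
  have hDb : D.card = b := by rw [← hCb, Set.ncard_eq_toFinset_card']
  set m : ℝ := (Fintype.card E : ℝ) with hm
  have hbm : (b : ℝ) ≤ m := by
    rw [← hDb, hm]; exact_mod_cast Finset.card_le_univ D
  -- choice of the small parameter
  obtain ⟨δ, hδ, hδb⟩ : ∃ δ : ℝ, 0 < δ ∧ ((b : ℝ) - ε) * (1 + m * δ) * (1 + m * δ) ≤ b := by
    have hcont : Continuous fun δ : ℝ => ((b : ℝ) - ε) * (1 + m * δ) * (1 + m * δ) := by fun_prop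
    have h0 : ((b : ℝ) - ε) * (1 + m * 0) * (1 + m * 0) < b := by simp; linarith
    have hev := hcont.continuousAt.eventually_lt (continuousAt_const (y := (b : ℝ))) h0
    have hev' := (hev.filter_mono (nhdsWithin_le_nhds (s := Set.Ioi 0))).and self_mem_nhdsWithin
    obtain ⟨δ, h1, h2⟩ := hev'.exists
    exact ⟨δ, h2, h1.le⟩
  let lam : E → ℝ := fun e => if e = e₁ then 1 else if e ∈ C then δ else 1 / δ
  have hl : ∀ e, 0 < lam e := by
    intro e
    simp only [lam]
    split_ifs <;> positivity
  have hm0 : 0 ≤ m := by positivity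
  have hLle : ∑ f ∈ D, lam f ≤ 1 + m * δ := by
    rw [← Finset.add_sum_erase D lam ((hD e₁).2 he₁)]
    have h1 : lam e₁ = 1 := by simp [lam]
    have h2 : ∑ f ∈ D.erase e₁, lam f ≤ (D.erase e₁).card • δ := by
      refine Finset.sum_le_card_nsmul _ _ _ fun f hf => ?_
      have hf1 := Finset.ne_of_mem_erase hf
      have hf2 := (hD f).1 (Finset.mem_of_mem_erase hf)
      simp [lam, hf1, hf2]
    have h3 : ((D.erase e₁).card : ℝ) ≤ m := by
      rw [hm]; exact_mod_cast Finset.card_le_univ _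
    rw [nsmul_eq_mul] at h2
    have := mul_le_mul_of_nonneg_right h3 hδ.le
    linarith
  have hLpos : 0 < ∑ f ∈ D, lam f := Finset.sum_pos (fun f _ => hl f) ⟨e₁, (hD e₁).2 he₁⟩
  -- bound on OPT
  have hOPT : sInf {c : ℝ | ∃ T, G.IsSpanningTree T ∧
      c = Multigraph.weight (fun e => 1 / lam e) T} ≤ 1 + m * δ := by
    have hconn : G.ConnectedOn (C \ {e₁})ᶜ :=
      not_not.mp (hC.2 (C \ {e₁}) ⟨Set.sdiff_subset, fun h => (h he₁).2 rfl⟩)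
    obtain ⟨T, hTs, hT⟩ := G.exists_spanningTree hconn
    have hw : Multigraph.weight (fun e => 1 / lam e) T ≤ 1 + m * δ := by
      rw [weight_eq_sum]
      have : ∀ e ∈ Finset.univ, (if e ∈ T then 1 / lam e else 0) ≤
          (if e = e₁ then (1 : ℝ) else 0) + δ := by
        intro e _
        by_cases h1 : e = e₁
        · simp only [lam, h1, if_true]
          split_ifs <;> norm_num <;> linarith
        · by_cases h2 : e ∈ T
          · have h3 : e ∉ C := fun h => hTs h2 ⟨h, h1⟩
            simp [lam, h1, h2, h3]
          · simp [h1, h2, hδ.le]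
      refine (Finset.sum_le_sum this).trans ?_
      rw [Finset.sum_add_distrib]
      simp [hm]
    refine le_trans (csInf_le ⟨0, ?_⟩ ⟨T, hT, rfl⟩) hw
    rintro c ⟨T, _, rfl⟩
    exact finsum_nonneg fun e => finsum_nonneg fun _ => (one_div_pos.mpr (hl e)).le
  refine ⟨lam, hl, fun TSAM hmeas hmst => ?_⟩
  have hprob : ∀ e, IsProbabilityMeasure (expMeasure (lam e)) :=
    fun e => isProbabilityMeasure_expMeasure (hl e)
  set μ := Measure.pi fun e : E => expMeasure (lam e) with hμ
  let A : E → Set (E → ℝ) := fun e => {x | ∀ f ∈ D, f ≠ e → x e < x f}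
  have hA : ∀ e, MeasurableSet (A e) := fun e => SamProb.measurableSet_strict_min D e
  have hint : Integrable (fun x => Multigraph.weight (fun e => 1 / lam e) (TSAM x)) μ := by
    have heq : (fun x => Multigraph.weight (fun e => 1 / lam e) (TSAM x)) =
        fun x => ∑ t : Set E, Set.indicator {x : E → ℝ | TSAM x = t}
          (fun _ => Multigraph.weight (fun e => 1 / lam e) t) x := by
      funext x
      rw [Finset.sum_eq_single (TSAM x)]
      · rw [Set.indicator_of_mem]; rfl
      · intro t _ ht
        exact Set.indicator_of_notMem (fun h => ht (Eq.symm h)) _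
      · intro h; exact absurd (Finset.mem_univ _) h
    rw [heq]
    exact integrable_finsetSum _ fun t _ => (integrable_const _).indicator (hmeas t)
  have hint2 : ∀ e ∈ D, Integrable ((A e).indicator fun _ => 1 / lam e) μ :=
    fun e _ => (integrable_const _).indicator (hA e)
  have hpt : ∀ x, ∑ e ∈ D, (A e).indicator (fun _ => 1 / lam e) x ≤
      Multigraph.weight (fun e => 1 / lam e) (TSAM x) := by
    intro x
    rw [weight_eq_sum]
    refine (Finset.sum_le_sum (f := fun e => (A e).indicator (fun _ => 1 / lam e) x)
      (g := fun e => if e ∈ TSAM x then 1 / lam e else 0) fun e he => ?_).trans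
      (Finset.sum_le_sum_of_subset_of_nonneg (Finset.subset_univ D) fun e _ _ => ?_)
    · have hpos := (one_div_pos.mpr (hl e)).le
      by_cases hxe : x ∈ A e
      · have := G.mem_mst_of_strict_min hC x (hmst x) ((hD e).1 he)
          (fun f hf hfe => hxe f ((hD f).2 hf) hfe)
        rw [Set.indicator_of_mem hxe]
        simp [this]
      · show (A e).indicator (fun _ => 1 / lam e) x ≤ _
        rw [Set.indicator_of_notMem hxe]
        split_ifs
        · exact hpos
        · exact le_rfl
    · have hpos := (one_div_pos.mpr (hl e)).le
      split_ifs
      · exact hpos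
      · exact le_rfl
  have hlow : (b : ℝ) / ∑ f ∈ D, lam f ≤
      ∫ x, Multigraph.weight (fun e => 1 / lam e) (TSAM x) ∂μ := by
    calc (b : ℝ) / ∑ f ∈ D, lam f
        = ∑ e ∈ D, ∫ x, (A e).indicator (fun _ => 1 / lam e) x ∂μ := by
          have : ∀ e ∈ D, ∫ x, (A e).indicator (fun _ => 1 / lam e) x ∂μ =
              1 / ∑ f ∈ D, lam f := by
            intro e he
            rw [integral_indicator_const _ (hA e), measureReal_def,
              SamProb.prob_strict_min lam hl D e he,
              ENNReal.toReal_ofReal (div_pos (hl e) hLpos).le, smul_eq_mul]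
            have := (hl e).ne'
            field_simp
          rw [Finset.sum_congr rfl this, Finset.sum_const, hDb, nsmul_eq_mul]
          ring
      _ = ∫ x, ∑ e ∈ D, (A e).indicator (fun _ => 1 / lam e) x ∂μ :=
          (integral_finsetSum _ hint2).symm
      _ ≤ _ := integral_mono (integrable_finsetSum _ hint2) hint hpt
  refine le_trans ?_ hlow
  rw [le_div_iff₀ hLpos]
  have hs := hsInf_nonneg lam hl
  refine le_trans ?_ hδb
  have hp : 0 ≤ 1 + m * δ := by positivity
  gcongr
end

section
/- Let G = (V,E) be a connected loopless multigraph with independent exponential sample weights w̃(e) ~ Exp(λ_e), λ_e > 0, and let SAM output a minimum spanning tree for the samples. For every edge e ∈ E, the expected true cost of SAM on G conditioned on the event that e has the minimum sample among all edges (equivalently, e is the first edge chosen by Kruskal's algorithm on the samples) satisfies: E[ Σ_{f∈T^SAM(w̃)} 1/λ_f | w̃(e) = min_{g∈E} w̃(g) ] − 1/λ_e = E[ Σ_{f∈T'(w̃')} 1/λ_f ], where T'(w̃') is the minimum spanning tree for independent samples w̃'(f) ~ Exp(λ_f) on the contraction G/e with the rates restricted to the edges of G/e. -/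
open scoped Classical

namespace Multigraph

variable {V E : Type*} (G : Multigraph V E)

lemma Reach.mono {G : Multigraph V E} {F F' : Set E} (h : F ⊆ F') {u v : V}
    (hr : G.Reach F u v) : G.Reach F' u v := by
  induction hr with
  | refl => exact Relation.ReflTransGen.refl
  | tail _ hxy ih =>
    obtain ⟨f, hf, hab⟩ := hxy
    exact ih.tail ⟨f, h hf, hab⟩

lemma Reach.symm {G : Multigraph V E} {F : Set E} {u v : V}
    (hr : G.Reach F u v) : G.Reach F v u := by
  induction hr with
  | refl => exact Relation.ReflTransGen.refl
  | tail _ hxy ih =>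
    obtain ⟨f, hf, hab⟩ := hxy
    exact Relation.ReflTransGen.head ⟨f, hf, by rw [hab, Sym2.eq_swap]⟩ ih

lemma Reach.trans {G : Multigraph V E} {F : Set E} {u v w : V}
    (h1 : G.Reach F u v) (h2 : G.Reach F v w) : G.Reach F u w :=
  Relation.ReflTransGen.trans h1 h2

lemma Reach.of_edge {G : Multigraph V E} {F : Set E} {u v : V} {f : E} (hf : f ∈ F)
    (h : G.ends f = s(u, v)) : G.Reach F u v :=
  Relation.ReflTransGen.single ⟨f, hf, h⟩

lemma exists_ends (f : E) : ∃ u v, G.ends f = s(u, v) := by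
  induction G.ends f using Sym2.inductionOn with
  | hf x y => exact ⟨x, y, rfl⟩

/-- A walk in `F + f` either avoids `f` or passes through it. -/
lemma Reach.of_insert {G : Multigraph V E} {F : Set E} {f : E} {a b u v : V}
    (hf : G.ends f = s(a, b)) (h : G.Reach (insert f F) u v) :
    G.Reach F u v ∨ (G.Reach F u a ∧ G.Reach F b v) ∨ (G.Reach F u b ∧ G.Reach F a v) := by
  induction h with
  | refl => exact Or.inl Relation.ReflTransGen.refl
  | @tail x y _ hxy ih =>
    obtain ⟨g, hg, hgxy⟩ := hxy
    rcases hg with rfl | hg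
    · rw [hf, Sym2.eq_iff] at hgxy
      rcases hgxy with ⟨rfl, rfl⟩ | ⟨rfl, rfl⟩
      · rcases ih with ih | ⟨h1, h2⟩ | ⟨h1, h2⟩
        · exact Or.inr (Or.inl ⟨ih, Relation.ReflTransGen.refl⟩)
        · exact Or.inr (Or.inl ⟨h1, Relation.ReflTransGen.refl⟩)
        · exact Or.inl h1
      · rcases ih with ih | ⟨h1, h2⟩ | ⟨h1, h2⟩
        · exact Or.inr (Or.inr ⟨ih, Relation.ReflTransGen.refl⟩)
        · exact Or.inl h1
        · exact Or.inr (Or.inr ⟨h1, Relation.ReflTransGen.refl⟩)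
    · have hs : G.Reach F x y := Reach.of_edge hg hgxy
      rcases ih with ih | ⟨h1, h2⟩ | ⟨h1, h2⟩
      · exact Or.inl (ih.trans hs)
      · exact Or.inr (Or.inl ⟨h1, h2.trans hs⟩)
      · exact Or.inr (Or.inr ⟨h1, h2.trans hs⟩)

/-- On a walk between distinct vertices there is an essential edge of some subset. -/
lemma Reach.exists_edge [Finite E] {G : Multigraph V E} {F : Set E} {u v : V} (huv : u ≠ v)
    (h : G.Reach F u v) : ∃ f ∈ F, ∃ a b, G.ends f = s(a, b) ∧
      G.Reach (F \ {f}) u a ∧ G.Reach (F \ {f}) b v := by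
  obtain ⟨F0, hF0⟩ := (Set.toFinite {S : Set E | S ⊆ F ∧ G.Reach S u v}).exists_minimal
    ⟨F, subset_rfl, h⟩
  obtain ⟨⟨hsub, hr⟩, hmin⟩ := hF0
  have hne : F0.Nonempty := by
    by_contra hne
    rw [Set.not_nonempty_iff_eq_empty] at hne
    subst hne
    rcases Relation.ReflTransGen.cases_head hr with h | ⟨c, ⟨g, hg, _⟩, _⟩
    · exact huv h
    · exact hg
  obtain ⟨f, hf⟩ := hne
  have hnr : ¬ G.Reach (F0 \ {f}) u v := fun hr' =>
    (hmin ⟨Set.sdiff_subset.trans hsub, hr'⟩ Set.sdiff_subset hf).2 rfl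
  have hmono : F0 \ {f} ⊆ F \ {f} := Set.sdiff_subset_sdiff_left hsub
  obtain ⟨a, b, hab⟩ := G.exists_ends f
  have hr2 : G.Reach (insert f (F0 \ {f})) u v := by
    rwa [Set.insert_sdiff_singleton, Set.insert_eq_of_mem hf]
  rcases hr2.of_insert hab with h | ⟨h1, h2⟩ | ⟨h1, h2⟩
  · exact absurd h hnr
  · exact ⟨f, hsub hf, a, b, hab, h1.mono hmono, h2.mono hmono⟩
  · exact ⟨f, hsub hf, b, a, by rw [hab, Sym2.eq_swap], h1.mono hmono, h2.mono hmono⟩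

lemma Acyclic.mono {G : Multigraph V E} {F F' : Set E} (h : F ⊆ F') (hF : G.Acyclic F') :
    G.Acyclic F := fun f hf u v huv hr =>
  hF f (h hf) u v huv (hr.mono (Set.sdiff_subset_sdiff_left h))

lemma Acyclic.insert_edge {G : Multigraph V E} {F : Set E} (hF : G.Acyclic F) {e : E} {u v : V}
    (he : G.ends e = s(u, v)) (hn : ¬ G.Reach F u v) : G.Acyclic (insert e F) := by
  have heF : e ∉ F := fun h => hn (Reach.of_edge h he)
  intro g hg a b hab hr
  by_cases hge : g = e
  · subst hge
    have hsub : insert g F \ {g} ⊆ F := by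
      rintro z ⟨hz | hz, hz'⟩
      · exact absurd hz hz'
      · exact hz
    rw [he, Sym2.eq_iff] at hab
    rcases hab with ⟨rfl, rfl⟩ | ⟨rfl, rfl⟩
    · exact hn (hr.mono hsub)
    · exact hn (hr.mono hsub).symm
  · have hgF : g ∈ F := hg.resolve_left hge
    have hr2 : G.Reach (insert e (F \ {g})) a b := by
      refine hr.mono ?_
      rintro z ⟨hz | hz, hz'⟩
      · exact Or.inl hz
      · exact Or.inr ⟨hz, hz'⟩
    have hab' : G.Reach F a b := Reach.of_edge hgF hab
    have hm : F \ {g} ⊆ F := Set.sdiff_subset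
    rcases hr2.of_insert he with h | ⟨h1, h2⟩ | ⟨h1, h2⟩
    · exact hF g hgF a b hab h
    · exact hn (((h1.mono hm).symm.trans hab').trans (h2.mono hm).symm)
    · exact hn (((h2.mono hm).trans hab'.symm).trans (h1.mono hm))

variable {G} in
lemma mk_eq_iff {e : E} {x y : V} :
    (Quotient.mk (G.contractSetoid e) x = Quotient.mk (G.contractSetoid e) y) ↔
      (x = y ∨ G.ends e = s(x, y)) := Quotient.eq (r := G.contractSetoid e)

/-- Reachability in the contraction. -/
lemma reach_contract_iff (e : E) (S : Set {f : E // f ≠ e ∧ G.ends f ≠ G.ends e}) (u v : V) :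
    (G.contract e).Reach S (Quotient.mk (G.contractSetoid e) u)
      (Quotient.mk (G.contractSetoid e) v) ↔
    G.Reach (insert e (Subtype.val '' S)) u v := by
  constructor
  · intro h
    have key : ∀ q, (G.contract e).Reach S (Quotient.mk (G.contractSetoid e) u) q →
        ∀ v, Quotient.mk (G.contractSetoid e) v = q →
          G.Reach (insert e (Subtype.val '' S)) u v := by
      have hq : ∀ x y, Quotient.mk (G.contractSetoid e) x = Quotient.mk (G.contractSetoid e) y →
          G.Reach (insert e (Subtype.val '' S)) x y := by
        intro x y hxy
        rcases mk_eq_iff.1 hxy with rfl | h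
        · exact Relation.ReflTransGen.refl
        · exact Reach.of_edge (Set.mem_insert _ _) h
      intro q hr
      induction hr with
      | refl => intro v hv; exact hq _ _ hv.symm
      | @tail p q _ hpq ih =>
        intro v hv
        obtain ⟨f, hf, hends⟩ := hpq
        obtain ⟨a, b, hab⟩ := G.exists_ends f.1
        have hfm : f.1 ∈ insert e (Subtype.val '' S) := Or.inr ⟨f, hf, rfl⟩
        have hends2 : s(Quotient.mk (G.contractSetoid e) a, Quotient.mk (G.contractSetoid e) b)
            = s(p, q) := by
          rw [← hends]
          simp [contract, hab]
        rw [Sym2.eq_iff] at hends2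
        have hab' : G.Reach (insert e (Subtype.val '' S)) a b := Reach.of_edge hfm hab
        rcases hends2 with ⟨h1, h2⟩ | ⟨h1, h2⟩
        · exact ((ih a h1).trans hab').trans (hq _ _ (h2.trans hv.symm))
        · exact ((ih b h2).trans hab'.symm).trans (hq _ _ (h1.trans hv.symm))
    exact key _ h v rfl
  · intro h
    induction h with
    | refl => exact Relation.ReflTransGen.refl
    | @tail x y _ hxy ih =>
      obtain ⟨f, hf, hfxy⟩ := hxy
      rcases hf with rfl | ⟨f, hf, rfl⟩
      · have : Quotient.mk (G.contractSetoid f) x = Quotient.mk (G.contractSetoid f) y :=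
          mk_eq_iff.2 (Or.inr hfxy)
        rwa [← this]
      · refine ih.trans (Reach.of_edge hf ?_)
        simp [contract, hfxy]

lemma acyclic_contract_iff [Finite E] (e : E)
    (S : Set {f : E // f ≠ e ∧ G.ends f ≠ G.ends e}) :
    (G.contract e).Acyclic S ↔ G.Acyclic (insert e (Subtype.val '' S)) := by
  have hdiff : ∀ f : {f : E // f ≠ e ∧ G.ends f ≠ G.ends e},
      insert e (Subtype.val '' S) \ {f.1} = insert e (Subtype.val '' (S \ {f})) := by
    intro f
    rw [Set.image_sdiff Subtype.val_injective, Set.image_singleton,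
      Set.insert_sdiff_of_notMem]
    exact fun h => f.2.1 h.symm
  constructor
  · intro h
    have heS : e ∉ Subtype.val '' S := by
      rintro ⟨f, _, hf⟩
      exact f.2.1 hf
    have aux : ∀ f ∈ S, ∀ a b, G.ends f.1 = s(a, b) →
        ¬ G.Reach (insert e (Subtype.val '' (S \ {f}))) a b := by
      intro f hf a b hab hr
      refine h f hf _ _ ?_ ((G.reach_contract_iff e (S \ {f}) a b).2 hr)
      simp [contract, hab]
    obtain ⟨u, v, huv⟩ := G.exists_ends e
    have hne : u ≠ v := by
      rintro rfl
      exact G.loopless e (by rw [huv]; exact rfl)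
    refine Acyclic.insert_edge ?_ huv ?_
    · rintro _ ⟨f, hf, rfl⟩ a b hab hr
      refine aux f hf a b hab (hr.mono ?_)
      rw [Set.image_sdiff Subtype.val_injective, Set.image_singleton]
      exact Set.subset_insert _ _
    · intro hr
      obtain ⟨_, ⟨f, hf, rfl⟩, a, b, hab, h1, h2⟩ := hr.exists_edge hne
      refine aux f hf a b hab ?_
      rw [← hdiff]
      have hm : Subtype.val '' S \ {f.1} ⊆ insert e (Subtype.val '' S) \ {f.1} :=
        Set.sdiff_subset_sdiff_left (Set.subset_insert _ _)
      have he : G.Reach (insert e (Subtype.val '' S) \ {f.1}) u v :=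
        Reach.of_edge ⟨Set.mem_insert _ _, fun h => f.2.1 h.symm⟩ huv
      exact ((h1.mono hm).symm.trans he).trans (h2.mono hm).symm
  · intro h f hf p q hpq hr
    induction p using Quotient.inductionOn with | h x => ?_
    induction q using Quotient.inductionOn with | h y => ?_
    rw [reach_contract_iff, ← hdiff] at hr
    obtain ⟨a, b, hab⟩ := G.exists_ends f.1
    have hn := h f.1 (Or.inr ⟨f, hf, rfl⟩) a b hab
    have hends2 : s(Quotient.mk (G.contractSetoid e) a, Quotient.mk (G.contractSetoid e) b)
        = s(Quotient.mk (G.contractSetoid e) x, Quotient.mk (G.contractSetoid e) y) := by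
      rw [← hpq]
      simp [contract, hab]
    have hq : ∀ x y, Quotient.mk (G.contractSetoid e) x = Quotient.mk (G.contractSetoid e) y →
        G.Reach (insert e (Subtype.val '' S) \ {f.1}) x y := by
      intro x y hxy
      rcases mk_eq_iff.1 hxy with rfl | h
      · exact Relation.ReflTransGen.refl
      · exact Reach.of_edge ⟨Set.mem_insert _ _, fun h => f.2.1 h.symm⟩ h
    rw [Sym2.eq_iff] at hends2
    rcases hends2 with ⟨h1, h2⟩ | ⟨h1, h2⟩
    · exact hn (((hq _ _ h1).trans hr).trans (hq _ _ h2.symm))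
    · exact hn (((hq _ _ h1).trans hr.symm).trans (hq _ _ h2.symm))

lemma card_contract [Finite V] (e : E) :
    Nat.card (Quotient (G.contractSetoid e)) + 1 = Nat.card V := by
  obtain ⟨u, v, huv⟩ := G.exists_ends e
  have hne : u ≠ v := by
    rintro rfl
    exact G.loopless e (by rw [huv]; exact rfl)
  have hb : Function.Bijective
      (fun x : {x : V // x ≠ v} => Quotient.mk (G.contractSetoid e) x.1) := by
    constructor
    · rintro ⟨x, hx⟩ ⟨y, hy⟩ hxy
      rcases mk_eq_iff.1 hxy with h | h
      · exact Subtype.ext h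
      · rw [huv, Sym2.eq_iff] at h
        rcases h with ⟨_, h⟩ | ⟨_, h⟩
        · exact absurd h.symm hy
        · exact absurd h.symm hx
    · intro q
      induction q using Quotient.inductionOn with | h x => ?_
      by_cases hx : x = v
      · exact ⟨⟨u, hne⟩, mk_eq_iff.2 (Or.inr (by rw [huv, hx]))⟩
      · exact ⟨⟨x, hx⟩, rfl⟩
  rw [← Nat.card_congr (Equiv.ofBijective _ hb)]
  have := Fintype.ofFinite V
  rw [Nat.card_eq_fintype_card, Nat.card_eq_fintype_card, Fintype.card_subtype_compl,
    Fintype.card_subtype_eq]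
  have : 0 < Fintype.card V := Fintype.card_pos_iff.2 ⟨u⟩
  omega

/-- Sets of the form `insert e (image of S)`. -/
lemma ncard_insert_image [Finite E] (e : E) (S : Set {f : E // f ≠ e ∧ G.ends f ≠ G.ends e}) :
    (insert e (Subtype.val '' S)).ncard = S.ncard + 1 := by
  rw [Set.ncard_insert_of_notMem, Set.ncard_image_of_injective _ Subtype.val_injective]
  rintro ⟨f, _, hf⟩
  exact f.2.1 hf

lemma two_le_card {V E : Type*} (G : Multigraph V E) [Finite V] (e : E) : 2 ≤ Nat.card V := by
  have h := G.card_contract e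
  obtain ⟨u, v, huv⟩ := G.exists_ends e
  have : Nonempty (Quotient (G.contractSetoid e)) := ⟨Quotient.mk _ u⟩
  have : 0 < Nat.card (Quotient (G.contractSetoid e)) := Nat.card_pos
  omega

lemma isSpanningTree_contract_iff [Finite V] [Finite E] (e : E)
    (S : Set {f : E // f ≠ e ∧ G.ends f ≠ G.ends e}) :
    (G.contract e).IsSpanningTree S ↔ G.IsSpanningTree (insert e (Subtype.val '' S)) := by
  unfold IsSpanningTree
  rw [acyclic_contract_iff, ncard_insert_image]
  have := G.card_contract e
  have := G.two_le_card e
  refine and_congr_left fun _ => ?_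
  omega

lemma Acyclic.eq_insert_image {G : Multigraph V E} {T : Set E} (hT : G.Acyclic T) {e : E}
    (he : e ∈ T) : insert e (Subtype.val ''
      (Subtype.val ⁻¹' T : Set {f : E // f ≠ e ∧ G.ends f ≠ G.ends e})) = T := by
  ext f
  constructor
  · rintro (rfl | ⟨f, hf, rfl⟩)
    · exact he
    · exact hf
  · intro hf
    by_cases hfe : f = e
    · exact Or.inl hfe
    · refine Or.inr ⟨⟨f, hfe, fun h => ?_⟩, hf, rfl⟩
      obtain ⟨u, v, huv⟩ := G.exists_ends e
      exact hT e he u v huv (Reach.of_edge (f := f) ⟨hf, hfe⟩ (h.trans huv))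

lemma connectedOn_of_spanning (n : ℕ) : ∀ {V E : Type*} [Finite V] [Finite E]
    (G : Multigraph V E) (T : Set E), Nat.card V = n → G.IsSpanningTree T → G.ConnectedOn T := by
  induction n with
  | zero =>
    intro V E _ _ G T hn _ u
    have : Nonempty V := ⟨u⟩
    have : 0 < Nat.card V := Nat.card_pos
    omega
  | succ n ih =>
    intro V E _ _ G T hn hT u v
    rcases T.eq_empty_or_nonempty with h | ⟨e, he⟩
    · have h0 := hT.1
      rw [h, Set.ncard_empty] at h0
      have : Nat.card V = 1 := by omega
      have := (Nat.card_eq_one_iff_unique.1 this).1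
      rw [Subsingleton.elim u v]
      exact Relation.ReflTransGen.refl
    · have hEq := hT.2.eq_insert_image he
      rw [← hEq, ← isSpanningTree_contract_iff] at hT
      have := ih (G.contract e) _ (by have := G.card_contract e; omega) hT
        (Quotient.mk _ u) (Quotient.mk _ v)
      rwa [reach_contract_iff, hEq] at this

/-- Exchange: an edge outside a spanning tree can be swapped in. -/
lemma IsSpanningTree.exchange [Finite V] [Finite E] {G : Multigraph V E} {T : Set E}
    (hT : G.IsSpanningTree T) {e : E} (he : e ∉ T) :
    ∃ f ∈ T, G.IsSpanningTree (insert e (T \ {f})) := by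
  obtain ⟨u, v, huv⟩ := G.exists_ends e
  have hne : u ≠ v := by
    rintro rfl
    exact G.loopless e (by rw [huv]; exact rfl)
  have hr : G.Reach T u v := connectedOn_of_spanning _ G T rfl hT u v
  obtain ⟨f, hf, a, b, hab, h1, h2⟩ := hr.exists_edge hne
  refine ⟨f, hf, ?_, ?_⟩
  · rw [Set.ncard_insert_of_notMem (fun h => he h.1), Set.ncard_sdiff_singleton_add_one hf]
    exact hT.1
  · refine Acyclic.insert_edge (hT.2.mono Set.sdiff_subset) huv ?_
    intro h
    exact hT.2 f hf a b hab ((h1.symm.trans h).trans h2.symm)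

lemma weight_insert [Finite E] (x : E → ℝ) {e : E} {S : Set E} (he : e ∉ S) :
    weight x (insert e S) = x e + weight x S := by
  unfold weight
  exact finsum_mem_insert x he (Set.toFinite _)

lemma weight_image_val {p : E → Prop} (x : E → ℝ) (S : Set {f : E // p f}) :
    weight x (Subtype.val '' S) = weight (fun f : {f : E // p f} => x f.1) S := by
  unfold weight
  exact finsum_mem_image (Subtype.val_injective.injOn)

lemma weight_sub_const [Finite E] (x : E → ℝ) (c : ℝ) (S : Set E) :
    weight (fun f => x f - c) S = weight x S - S.ncard * c := by
  unfold weight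
  rw [finsum_mem_eq_finite_toFinset_sum _ (Set.toFinite S),
    finsum_mem_eq_finite_toFinset_sum _ (Set.toFinite S), Finset.sum_sub_distrib,
    Finset.sum_const, Set.ncard_eq_toFinset_card S (Set.toFinite S), nsmul_eq_mul]

/-- The deterministic part: a generic `x` whose minimum is at `e`. -/
lemma tree_contract [Finite V] [Finite E] (G : Multigraph V E) (e : E) (x : E → ℝ)
    (hgen : ∀ S T : Set E, weight x S = weight x T → S = T)
    (hmin : ∀ g, x e ≤ x g) (T : Set E) (hT : G.IsSpanningTree T)
    (hTo : ∀ T', G.IsSpanningTree T' → weight x T ≤ weight x T')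
    (S : Set {f : E // f ≠ e ∧ G.ends f ≠ G.ends e}) (hS : (G.contract e).IsSpanningTree S)
    (hSo : ∀ S', (G.contract e).IsSpanningTree S' →
      weight (fun f : {f : E // f ≠ e ∧ G.ends f ≠ G.ends e} => x f.1 - x e) S
        ≤ weight (fun f : {f : E // f ≠ e ∧ G.ends f ≠ G.ends e} => x f.1 - x e) S') :
    T = insert e (Subtype.val '' S) := by
  have he : e ∈ T := by
    by_contra he
    obtain ⟨f, hf, hT2⟩ := hT.exchange he
    have h1 := hTo _ hT2
    have hw : weight x T = x f + weight x (T \ {f}) := by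
      rw [← weight_insert x (fun h : f ∈ T \ {f} => h.2 rfl), Set.insert_sdiff_singleton,
        Set.insert_eq_of_mem hf]
    have h2 := weight_insert x (fun h : e ∈ T \ {f} => he h.1)
    have h3 := hgen T (insert e (T \ {f})) (le_antisymm h1 (by linarith [hmin f]))
    exact he (h3 ▸ Set.mem_insert _ _)
  have hnot : ∀ S : Set {f : E // f ≠ e ∧ G.ends f ≠ G.ends e}, e ∉ Subtype.val '' S := by
    rintro S ⟨f, _, hf⟩
    exact f.2.1 hf
  have hEq := hT.2.eq_insert_image he
  set S0 : Set {f : E // f ≠ e ∧ G.ends f ≠ G.ends e} := Subtype.val ⁻¹' T with hS0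
  have hS0t : (G.contract e).IsSpanningTree S0 := by
    rw [isSpanningTree_contract_iff, hEq]; exact hT
  have h1 := hSo S0 hS0t
  rw [weight_sub_const (fun f : {f : E // f ≠ e ∧ G.ends f ≠ G.ends e} => x f.1),
    weight_sub_const (fun f : {f : E // f ≠ e ∧ G.ends f ≠ G.ends e} => x f.1),
    hS.1, hS0t.1, ← weight_image_val, ← weight_image_val] at h1
  apply hgen
  apply le_antisymm
  · exact hTo _ ((isSpanningTree_contract_iff G e S).1 hS)
  · rw [← hEq, weight_insert _ (hnot _), weight_insert _ (hnot _)]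
    linarith

end Multigraph

section Prob

open MeasureTheory ProbabilityTheory

lemma pi_map_update {ι : Type*} [Fintype ι] (ν : ι → Measure ℝ) [∀ i, IsProbabilityMeasure (ν i)]
    (i : ι) : ((ν i).prod (Measure.pi ν)).map (fun p => Function.update p.2 i p.1)
      = Measure.pi ν := by
  have hm : Measurable (fun p : ℝ × (ι → ℝ) => Function.update p.2 i p.1) := by
    rw [measurable_pi_iff]
    intro j
    by_cases h : j = i
    · subst h
      simpa using measurable_fst
    · simp only [Function.update_of_ne h]
      exact (measurable_pi_apply j).comp measurable_snd
  symm
  refine Measure.pi_eq ?_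
  intro s hs
  rw [Measure.map_apply hm (MeasurableSet.univ_pi hs)]
  have hpre : (fun p : ℝ × (ι → ℝ) => Function.update p.2 i p.1) ⁻¹' (Set.univ.pi s)
      = s i ×ˢ Set.univ.pi (Function.update s i Set.univ) := by
    ext ⟨t, x⟩
    simp only [Set.mem_preimage, Set.mem_univ_pi, Set.mem_prod]
    constructor
    · intro h
      refine ⟨by simpa using h i, fun j => ?_⟩
      by_cases hj : j = i
      · subst hj; simp
      · simpa [Function.update_of_ne hj] using h j
    · rintro ⟨h1, h2⟩ j
      by_cases hj : j = i
      · subst hj; simpa using h1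
      · simpa [Function.update_of_ne hj] using h2 j
  rw [hpre, Measure.prod_prod, Measure.pi_pi,
    ← Finset.mul_prod_erase Finset.univ _ (Finset.mem_univ i),
    ← Finset.mul_prod_erase Finset.univ (fun j => ν j (s j)) (Finset.mem_univ i)]
  simp only [Function.update_self, measure_univ, one_mul]
  congr 1
  refine Finset.prod_congr rfl fun j hj => ?_
  rw [Function.update_of_ne (Finset.ne_of_mem_erase hj)]

lemma measurable_update_pair {ι : Type*} (i : ι) :
    Measurable (fun p : ℝ × (ι → ℝ) => Function.update p.2 i p.1) := by
  rw [measurable_pi_iff]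
  intro j
  by_cases h : j = i
  · subst h
    simpa using measurable_fst
  · simp only [Function.update_of_ne h]
    exact (measurable_pi_apply j).comp measurable_snd

lemma expMeasure_eq (r : ℝ) : expMeasure r = volume.withDensity (exponentialPDF r) := rfl

lemma measurable_exponentialPDF' (r : ℝ) : Measurable (exponentialPDF r) :=
  (measurable_exponentialPDFReal r).ennreal_ofReal

lemma expMeasure_singleton (r t : ℝ) : expMeasure r {t} = 0 := by
  have h : expMeasure r ≪ volume := by
    rw [expMeasure_eq]; exact withDensity_absolutelyContinuous _ _
  exact h (by simp)

lemma expMeasure_ae_nonneg (r : ℝ) : ∀ᵐ t ∂(expMeasure r), 0 ≤ t := by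
  rw [ae_iff]
  have : {a : ℝ | ¬ 0 ≤ a} = Set.Iio 0 := by ext; simp
  rw [this, expMeasure_eq, withDensity_apply _ measurableSet_Iio]
  exact lintegral_exponentialPDF_of_nonpos le_rfl

/-- Memorylessness of the exponential distribution. -/
lemma expMeasure_shift (r : ℝ) {t : ℝ} (ht : 0 ≤ t) {s : Set ℝ} (hs : MeasurableSet s) :
    expMeasure r {z | t ≤ z ∧ z - t ∈ s} = ENNReal.ofReal (Real.exp (-(r * t))) * expMeasure r s := by
  have hm : MeasurableSet {z : ℝ | t ≤ z ∧ z - t ∈ s} :=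
    measurableSet_Ici.inter ((measurable_id.sub_const t) hs)
  rw [expMeasure_eq, withDensity_apply _ hm, withDensity_apply _ hs,
    ← lintegral_indicator hm, ← lintegral_indicator hs,
    ← lintegral_const_mul _ ((measurable_exponentialPDF' r).indicator hs),
    ← lintegral_add_right_eq_self _ t]
  refine lintegral_congr fun z => ?_
  by_cases hz : z ∈ s
  · by_cases h0 : 0 ≤ z
    · have h1 : z + t ∈ {z : ℝ | t ≤ z ∧ z - t ∈ s} := ⟨by linarith, by simpa using hz⟩
      rw [Set.indicator_of_mem h1, Set.indicator_of_mem hz, exponentialPDF_of_nonneg h0,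
        exponentialPDF_of_nonneg (by linarith), ← ENNReal.ofReal_mul (Real.exp_pos _).le]
      congr 1
      rw [mul_left_comm, ← Real.exp_add]
      congr 2
      ring
    · have h1 : z + t ∉ {z : ℝ | t ≤ z ∧ z - t ∈ s} := fun h => h0 (by linarith [h.1])
      rw [Set.indicator_of_notMem h1, Set.indicator_of_mem hz,
        exponentialPDF_of_neg (not_le.1 h0), mul_zero]
  · have h1 : z + t ∉ {z : ℝ | t ≤ z ∧ z - t ∈ s} := fun h => hz (by simpa using h.2)
    rw [Set.indicator_of_notMem h1, Set.indicator_of_notMem hz, mul_zero]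

lemma measurable_weight {E : Type*} [Finite E] (S : Set E) :
    Measurable (fun x : E → ℝ => Multigraph.weight x S) := by
  have := Fintype.ofFinite E
  unfold Multigraph.weight
  simp_rw [finsum_mem_eq_finite_toFinset_sum _ (Set.toFinite S)]
  fun_prop

lemma weight_update {E : Type*} (x : E → ℝ) {i : E} {S : Set E} (hi : i ∉ S) (t : ℝ) :
    Multigraph.weight (Function.update x i t) S = Multigraph.weight x S := by
  unfold Multigraph.weight
  refine finsum_mem_congr rfl fun j hj => ?_
  rw [Function.update_of_ne]
  rintro rfl
  exact hi hj

lemma ae_generic_pair {E : Type*} [Fintype E] (lam : E → ℝ) (hlam : ∀ f, 0 < lam f)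
    (S T : Set E) (i : E) (hS : i ∈ S) (hT : i ∉ T) :
    ∀ᵐ x ∂(Measure.pi fun f : E => expMeasure (lam f)),
      Multigraph.weight x S ≠ Multigraph.weight x T := by
  have : ∀ f, IsProbabilityMeasure (expMeasure (lam f)) := fun f =>
    isProbabilityMeasure_expMeasure (hlam f)
  have hms : MeasurableSet {x : E → ℝ | Multigraph.weight x S = Multigraph.weight x T} :=
    measurableSet_eq_fun (measurable_weight S) (measurable_weight T)
  rw [ae_iff]
  simp only [ne_eq, not_not]
  rw [← pi_map_update _ i, Measure.map_apply (measurable_update_pair i) hms,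
    Measure.prod_apply_symm (measurable_update_pair i hms)]
  refine (lintegral_congr fun x => ?_).trans lintegral_zero
  refine measure_mono_null ?_
    (expMeasure_singleton (lam i) (Multigraph.weight x T - Multigraph.weight x (S \ {i})))
  intro t ht
  have ht : Multigraph.weight (Function.update x i t) S
      = Multigraph.weight (Function.update x i t) T := ht
  have hi : i ∉ S \ {i} := fun h => h.2 rfl
  have hS2 : insert i (S \ {i}) = S := by
    rw [Set.insert_sdiff_singleton, Set.insert_eq_of_mem hS]
  have h2 := Multigraph.weight_insert (Function.update x i t) hi
  rw [hS2, ht, weight_update x hT, weight_update x hi, Function.update_self] at h2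
  rw [Set.mem_singleton_iff]
  linarith

lemma ae_generic {E : Type*} [Fintype E] (lam : E → ℝ) (hlam : ∀ f, 0 < lam f) :
    ∀ᵐ x ∂(Measure.pi fun f : E => expMeasure (lam f)),
      ∀ S T : Set E, Multigraph.weight x S = Multigraph.weight x T → S = T := by
  rw [ae_all_iff]
  intro S
  rw [ae_all_iff]
  intro T
  by_cases hST : S = T
  · exact Filter.Eventually.of_forall fun _ _ => hST
  · have : (∃ i ∈ S, i ∉ T) ∨ (∃ i ∈ T, i ∉ S) := by
      by_contra! h
      exact hST (Set.Subset.antisymm h.1 h.2)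
    rcases this with ⟨i, h1, h2⟩ | ⟨i, h1, h2⟩
    · filter_upwards [ae_generic_pair lam hlam S T i h1 h2] with x hx h
      exact absurd h hx
    · filter_upwards [ae_generic_pair lam hlam T S i h1 h2] with x hx h
      exact absurd h.symm hx

lemma measurableSet_min {E : Type*} [Finite E] (e : E) :
    MeasurableSet {x : E → ℝ | ∀ g, x e ≤ x g} := by
  rw [Set.ofPred_forall]
  exact MeasurableSet.iInter fun g =>
    measurableSet_le (measurable_pi_apply e) (measurable_pi_apply g)

/-- Joint law of the excesses on the event that `e` is minimal. -/
lemma measure_min_inter {E : Type*} [Fintype E] (lam : E → ℝ) (hlam : ∀ f, 0 < lam f) (e : E)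
    (s : E → Set ℝ) (hs : ∀ f, MeasurableSet (s f)) (hse : s e = Set.univ) :
    (Measure.pi fun f : E => expMeasure (lam f))
      ({x : E → ℝ | ∀ g, x e ≤ x g} ∩ {x | ∀ f, x f - x e ∈ s f})
    = (∫⁻ t, ∏ f ∈ Finset.univ.erase e, ENNReal.ofReal (Real.exp (-(lam f * t)))
        ∂(expMeasure (lam e))) * ∏ f, expMeasure (lam f) (s f) := by
  have hp : ∀ f, IsProbabilityMeasure (expMeasure (lam f)) := fun f =>
    isProbabilityMeasure_expMeasure (hlam f)
  have hms : MeasurableSet ({x : E → ℝ | ∀ g, x e ≤ x g} ∩ {x | ∀ f, x f - x e ∈ s f}) := by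
    refine (measurableSet_min e).inter ?_
    rw [Set.ofPred_forall]
    exact MeasurableSet.iInter fun g =>
      ((measurable_pi_apply g).sub (measurable_pi_apply e)) (hs g)
  conv_lhs => rw [← pi_map_update (fun f : E => expMeasure (lam f)) e]
  rw [Measure.map_apply (measurable_update_pair e) hms,
    Measure.prod_apply (measurable_update_pair e hms), ← lintegral_mul_const]
  · refine lintegral_congr_ae ?_
    filter_upwards [expMeasure_ae_nonneg (lam e)] with t ht
    have hpre : Prod.mk t ⁻¹' ((fun p : ℝ × (E → ℝ) => Function.update p.2 e p.1) ⁻¹'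
        ({x : E → ℝ | ∀ g, x e ≤ x g} ∩ {x | ∀ f, x f - x e ∈ s f}))
        = Set.univ.pi (Function.update (fun f => {z | t ≤ z ∧ z - t ∈ s f}) e Set.univ) := by
      ext x
      simp only [Set.mem_preimage, Set.mem_inter_iff, Set.mem_ofPred_eq, Set.mem_univ_pi,
        Function.update_self]
      constructor
      · rintro ⟨h1, h2⟩ j
        by_cases hj : j = e
        · subst hj; simp
        · have h1 := h1 j
          have h2 := h2 j
          rw [Function.update_of_ne hj] at h1 h2 ⊢
          exact ⟨h1, h2⟩
      · intro h
        refine ⟨fun j => ?_, fun j => ?_⟩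
        · by_cases hj : j = e
          · subst hj; simp
          · have h := h j
            rw [Function.update_of_ne hj] at h ⊢
            exact h.1
        · by_cases hj : j = e
          · subst hj; rw [hse]; trivial
          · have h := h j
            rw [Function.update_of_ne hj] at h ⊢
            exact h.2
    rw [hpre, Measure.pi_pi, ← Finset.mul_prod_erase Finset.univ _ (Finset.mem_univ e),
      ← Finset.mul_prod_erase Finset.univ (fun f => expMeasure (lam f) (s f)) (Finset.mem_univ e),
      hse]
    simp only [Function.update_self, measure_univ, one_mul]
    rw [← Finset.prod_mul_distrib]
    refine Finset.prod_congr rfl fun j hj => ?_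
    rw [Function.update_of_ne (Finset.ne_of_mem_erase hj)]
    exact expMeasure_shift _ ht (hs j)
  · refine Finset.measurable_prod _ fun f _ => ?_
    fun_prop

lemma measure_min_eq {E : Type*} [Fintype E] (lam : E → ℝ) (hlam : ∀ f, 0 < lam f) (e : E) :
    (Measure.pi fun f : E => expMeasure (lam f)) {x : E → ℝ | ∀ g, x e ≤ x g}
    = (∫⁻ t, ∏ f ∈ Finset.univ.erase e, ENNReal.ofReal (Real.exp (-(lam f * t)))
        ∂(expMeasure (lam e))) := by
  have hp : ∀ f, IsProbabilityMeasure (expMeasure (lam f)) := fun f =>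
    isProbabilityMeasure_expMeasure (hlam f)
  have h := measure_min_inter lam hlam e (fun _ => Set.univ) (fun _ => MeasurableSet.univ) rfl
  simpa using h

lemma measure_min_ne_zero {E : Type*} [Fintype E] (lam : E → ℝ) (hlam : ∀ f, 0 < lam f) (e : E) :
    (Measure.pi fun f : E => expMeasure (lam f)) {x : E → ℝ | ∀ g, x e ≤ x g} ≠ 0 := by
  have hp : ∀ f, IsProbabilityMeasure (expMeasure (lam f)) := fun f =>
    isProbabilityMeasure_expMeasure (hlam f)
  rw [measure_min_eq lam hlam e]
  intro h
  rw [lintegral_eq_zero_iff (Finset.measurable_prod _ fun f _ => by fun_prop)] at h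
  have h2 : ∀ᵐ t ∂(expMeasure (lam e)), False := by
    filter_upwards [h] with t ht
    simp only [Pi.zero_apply, Finset.prod_eq_zero_iff, ENNReal.ofReal_eq_zero] at ht
    obtain ⟨f, _, hf⟩ := ht
    exact absurd (Real.exp_pos _) (not_lt.2 hf)
  simp at h2
  exact (IsProbabilityMeasure.ne_zero _ h2)

/-- Conditional law of the excesses. -/
lemma map_cond_min {E : Type*} [Fintype E] (lam : E → ℝ) (hlam : ∀ f, 0 < lam f) (e : E)
    (p : E → Prop) [Fintype {f // p f}] (hpe : ¬ p e) :
    (((Measure.pi fun f : E => expMeasure (lam f))[|{x : E → ℝ | ∀ g, x e ≤ x g}]).map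
      (fun x => fun f : {f // p f} => x f.1 - x e))
    = Measure.pi fun f : {f // p f} => expMeasure (lam f.1) := by
  have hp : ∀ f, IsProbabilityMeasure (expMeasure (lam f)) := fun f =>
    isProbabilityMeasure_expMeasure (hlam f)
  have hm : Measurable (fun x : E → ℝ => fun f : {f // p f} => x f.1 - x e) := by fun_prop
  symm
  refine Measure.pi_eq ?_
  intro s hs
  rw [Measure.map_apply hm (MeasurableSet.univ_pi hs), cond_apply (measurableSet_min e)]
  set s' : E → Set ℝ := fun f => if h : p f then s ⟨f, h⟩ else Set.univ with hs'
  have hs'm : ∀ f, MeasurableSet (s' f) := by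
    intro f
    by_cases h : p f
    · simpa [hs', h] using hs ⟨f, h⟩
    · simp [hs', h]
  have hset : (fun x : E → ℝ => fun f : {f // p f} => x f.1 - x e) ⁻¹' Set.univ.pi s
      = {x | ∀ f, x f - x e ∈ s' f} := by
    ext x
    simp only [Set.mem_preimage, Set.mem_univ_pi, Set.mem_ofPred_eq]
    constructor
    · intro h f
      by_cases hf : p f
      · simpa [hs', hf] using h ⟨f, hf⟩
      · simp [hs', hf]
    · rintro h ⟨f, hf⟩
      simpa [hs', hf] using h f
  rw [hset, measure_min_inter lam hlam e s' hs'm (by simp [hs', hpe]), ← measure_min_eq lam hlam e,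
    ← mul_assoc, ENNReal.inv_mul_cancel (measure_min_ne_zero lam hlam e) (measure_ne_top _ _),
    one_mul, ← Finset.prod_subset (Finset.subset_univ (Finset.univ.filter p)),
    Finset.prod_subtype (p := p) _ (by simp)]
  · refine Finset.prod_congr rfl ?_
    rintro ⟨f, hf⟩ _
    simp [hs', hf]
  · intro f _ hf
    have hf : ¬ p f := by simpa using hf
    simp [hs', hf]

end Prob

open Multigraph MeasureTheory ProbabilityTheory in
/-- Conditioned on edge `e` having the minimum sample, the expected true
cost of the sample-based MST algorithm on `G`, minus `1/λ_e`, equals the expected true cost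
of the sample-based MST algorithm on the contraction `G/e` (with the rates restricted to the
edges of `G/e`). -/
theorem sample_mst_conditional_contract {V E : Type*} [Finite V] [Fintype E]
    (G : Multigraph V E) (hG : G.Connected)
    (lam : E → ℝ) (hlam : ∀ f, 0 < lam f) (e : E)
    (TSAM : (E → ℝ) → Set E)
    (hmeas : ∀ t : Set E, MeasurableSet {x : E → ℝ | TSAM x = t})
    (hopt : ∀ x : E → ℝ, G.IsSpanningTree (TSAM x) ∧
      ∀ T, G.IsSpanningTree T → Multigraph.weight x (TSAM x) ≤ Multigraph.weight x T)
    (T' : ({f : E // f ≠ e ∧ G.ends f ≠ G.ends e} → ℝ) →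
      Set {f : E // f ≠ e ∧ G.ends f ≠ G.ends e})
    (hmeas' : ∀ t, MeasurableSet {y | T' y = t})
    (hopt' : ∀ y, (G.contract e).IsSpanningTree (T' y) ∧
      ∀ T, (G.contract e).IsSpanningTree T →
        Multigraph.weight y (T' y) ≤ Multigraph.weight y T) :
    (∫ x, Multigraph.weight (fun f => 1 / lam f) (TSAM x)
        ∂((Measure.pi fun f : E => expMeasure (lam f))[|{x : E → ℝ | ∀ g, x e ≤ x g}]))
      - 1 / lam e
    = ∫ y, Multigraph.weight (fun f : {f : E // f ≠ e ∧ G.ends f ≠ G.ends e} => 1 / lam f.1)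
          (T' y)
        ∂(Measure.pi fun f : {f : E // f ≠ e ∧ G.ends f ≠ G.ends e} => expMeasure (lam f.1)) := by
  have hp : ∀ f, IsProbabilityMeasure (expMeasure (lam f)) := fun f =>
    isProbabilityMeasure_expMeasure (hlam f)
  have hcp : IsProbabilityMeasure
      ((Measure.pi fun f : E => expMeasure (lam f))[|{x : E → ℝ | ∀ g, x e ≤ x g}]) :=
    cond_isProbabilityMeasure (measure_min_ne_zero lam hlam e)
  have hm : Measurable (fun x : E → ℝ =>
      fun f : {f : E // f ≠ e ∧ G.ends f ≠ G.ends e} => x f.1 - x e) := by fun_prop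
  set g : Set {f : E // f ≠ e ∧ G.ends f ≠ G.ends e} → ℝ := fun t =>
    Multigraph.weight (fun f : {f : E // f ≠ e ∧ G.ends f ≠ G.ends e} => 1 / lam f.1) t with hg
  have hgm : Measurable (fun y => g (T' y)) := by
    intro U _
    have : (fun y => g (T' y)) ⁻¹' U = ⋃ t ∈ {t | g t ∈ U}, {y | T' y = t} := by
      ext y; simp
    rw [this]
    exact MeasurableSet.biUnion (Set.to_countable _) fun t _ => hmeas' t
  rw [← map_cond_min lam hlam e (fun f => f ≠ e ∧ G.ends f ≠ G.ends e) (fun h => h.1 rfl),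
    integral_map hm.aemeasurable hgm.aestronglyMeasurable]
  have hae : ∀ᵐ x ∂((Measure.pi fun f : E => expMeasure (lam f))[|{x : E → ℝ | ∀ g, x e ≤ x g}]),
      Multigraph.weight (fun f => 1 / lam f) (TSAM x) = 1 / lam e +
        g (T' (fun f : {f : E // f ≠ e ∧ G.ends f ≠ G.ends e} => x f.1 - x e)) := by
    filter_upwards [ae_cond_mem (measurableSet_min e),
      cond_absolutelyContinuous.ae_le (ae_generic lam hlam)] with x hx hgen
    have ht := tree_contract G e x hgen hx (TSAM x) (hopt x).1 (hopt x).2 _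
      (hopt' (fun f => x f.1 - x e)).1 (hopt' (fun f => x f.1 - x e)).2
    rw [ht, weight_insert, weight_image_val]
    rintro ⟨f, _, hf⟩
    exact f.2.1 hf
  rw [integral_congr_ae hae, integral_add (integrable_const _), integral_const]
  · simp
  · obtain ⟨C, hC⟩ := (Set.finite_range fun t => ‖g t‖).bddAbove
    exact Integrable.of_bound (hgm.comp hm).aestronglyMeasurable C
      (Filter.Eventually.of_forall fun x => hC ⟨_, rfl⟩)
end
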